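/- Let K ≥ 3 and let p ∈ 𝔓_>([L]). The set of tuples (X_1,…,X_K,p') with X_1,…,X_K ∈ Gl_1(L) and p' ∈ 𝔓_>([L]) satisfying p^{(K)} = (X_1⊗…⊗X_K) p'^{(K)} has exactly L! elements. -/

import Mathlib

open scoped BigOperators

/-- `p` is a probability distribution on `Fin L`. -/
def probDist {L : ℕ} (p : Fin L → ℝ) : Prop :=
  (∀ i, 0 ≤ p i) ∧ ∑ i, p i = 1

/-- `p` is a probability distribution on `Fin L` with all entries strictly positive. -/
def probPos {L : ℕ} (p : Fin L → ℝ) : Prop :=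
  (∀ i, 0 < p i) ∧ ∑ i, p i = 1

/-- `p^{(K)}`: the function on `[L]^K` equal to `p i` on the constant tuple `(i,…,i)`
and `0` elsewhere. -/
def diagEmbed {L : ℕ} (p : Fin L → ℝ) (K : ℕ) : (Fin K → Fin L) → ℝ :=
  fun y => ∑ i, if (∀ k, y k = i) then p i else 0

/-- The action of `X_1 ⊗ … ⊗ X_K` on functions `[L]^K → ℝ`. -/
def tensorAct {L L' K : ℕ} (X : Fin K → Matrix (Fin L') (Fin L) ℝ)
    (v : (Fin K → Fin L) → ℝ) : (Fin K → Fin L') → ℝ :=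
  fun y => ∑ x : Fin K → Fin L, v x * ∏ k, X k (y k) (x k)

/-- A channel from `[L]` to `[L']`: an `L' × L` column-stochastic matrix. -/
def isChannel {L L' : ℕ} (W : Matrix (Fin L') (Fin L) ℝ) : Prop :=
  (∀ i j, 0 ≤ W i j) ∧ ∀ j, ∑ i, W i j = 1

/-- `Gl_1(L)`: invertible matrices whose columns each sum to `1`. -/
def Gl1 {L : ℕ} (X : Matrix (Fin L) (Fin L) ℝ) : Prop :=
  IsUnit X ∧ ∀ j, ∑ i, X i j = 1

theorem sum_diagEmbed_mul {L K : ℕ} (p : Fin L → ℝ) (g : (Fin K → Fin L) → ℝ) :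
    ∑ x, diagEmbed p K x * g x = ∑ i, p i * g (fun _ => i) := by
  simp only [diagEmbed, Finset.sum_mul]
  rw [Finset.sum_comm]
  refine Finset.sum_congr rfl fun i _ => ?_
  simp only [← funext_iff (g := fun _ : Fin K => i), ite_mul, zero_mul]
  simp

theorem tensorAct_diagEmbed {L L' K : ℕ} (X : Fin K → Matrix (Fin L') (Fin L) ℝ)
    (p : Fin L → ℝ) (y : Fin K → Fin L') :
    tensorAct X (diagEmbed p K) y = ∑ i, p i * ∏ k, X k (y k) i :=
  sum_diagEmbed_mul p fun x => ∏ k, X k (y k) (x k)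

/-- The equation `p^{(K)} = (X_1 ⊗ … ⊗ X_K) p'^{(K)}` paired with a product test function. -/
theorem sum_mul_prod_eq_of_diagEmbed_eq {L K : ℕ} {X : Fin K → Matrix (Fin L) (Fin L) ℝ}
    {p q : Fin L → ℝ} (h : diagEmbed p K = tensorAct X (diagEmbed q K))
    (f : Fin K → Fin L → ℝ) :
    ∑ i, p i * ∏ k, f k i = ∑ i, q i * ∏ k, ∑ y, f k y * X k y i := by
  rw [← sum_diagEmbed_mul p fun x => ∏ k, f k (x k), h]
  simp only [tensorAct_diagEmbed, Finset.sum_mul, Finset.prod_univ_sum, Finset.mul_sum,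
    Fintype.piFinset_univ, Finset.prod_mul_distrib]
  rw [Finset.sum_comm]
  refine Finset.sum_congr rfl fun i _ => Finset.sum_congr rfl fun x _ => ?_
  ring

/-- Entries of two different factors of a solution are supported on a common diagonal. -/
theorem mul_entry_eq_of_diagEmbed_eq {L K : ℕ} {X : Fin K → Matrix (Fin L) (Fin L) ℝ}
    {p q : Fin L → ℝ} (hX : ∀ k, Gl1 (X k)) (hq : ∀ i, 0 < q i)
    (h : diagEmbed p K = tensorAct X (diagEmbed q K)) {k l m : Fin K} (hkl : k ≠ l)
    (hkm : k ≠ m) (hlm : l ≠ m) (a c j : Fin L) :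
    X k a j * X l c j = if a = c then X k a j else 0 := by
  have hrow (i : Fin L) : ∑ y, (X m)⁻¹ j y * X m y i = if j = i then 1 else 0 := by
    rw [← Matrix.mul_apply, Matrix.nonsing_inv_mul _ ((Matrix.isUnit_iff_isUnit_det _).1 (hX m).1),
      Matrix.one_apply]
  have hprod (u v w : ℝ) : ∏ n, (if n = k then u else if n = l then v else if n = m then w else 1)
      = u * v * w := by
    rw [← Finset.prod_subset (Finset.subset_univ {k, l, m})]
    · simp [hkl, hkm, hlm, hkl.symm, hkm.symm, hlm.symm, mul_assoc]
    · simp +contextual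
  have key (g : Fin L → ℝ) : p a * g a * (X m)⁻¹ j a = q j * X k a j * ∑ y, g y * X l y j := by
    have := sum_mul_prod_eq_of_diagEmbed_eq h fun n y =>
      if n = k then (if a = y then 1 else 0) else if n = l then g y else
        if n = m then (X m)⁻¹ j y else 1
    have hr (i : Fin L) (n : Fin K) : (∑ y, (if n = k then (if a = y then 1 else 0) else
        if n = l then g y else if n = m then (X m)⁻¹ j y else 1) * X n y i)
        = if n = k then X k a i else if n = l then ∑ y, g y * X l y i else
          if n = m then (if j = i then 1 else 0) else 1 := by
      split_ifs with h1 h2 h3 h4 <;> subst_vars <;> simp_all [(hX _).2]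
    simp only [hr, hprod] at this
    simpa [mul_assoc] using this
  have h1 := key fun _ => 1
  have h2 := key fun y => if c = y then 1 else 0
  simp only [one_mul, (hX l).2, ite_mul, zero_mul, Finset.sum_ite_eq, Finset.mem_univ, if_true,
    mul_one] at h1 h2
  apply mul_left_cancel₀ (hq j).ne'
  rw [← mul_assoc, ← h2]
  by_cases hac : a = c
  · subst hac
    simpa using h1
  · simp [hac, Ne.symm hac]

/-- The matrix sending `δ_i` to `δ_{σ i}`. -/
def permChannel {L : ℕ} (σ : Fin L → Fin L) : Matrix (Fin L) (Fin L) ℝ :=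
  fun y i => if y = σ i then 1 else 0

theorem permChannel_injective {L : ℕ} :
    Function.Injective (permChannel : (Fin L → Fin L) → Matrix (Fin L) (Fin L) ℝ) := by
  intro σ τ h
  ext1 i
  by_contra hne
  have := congrFun (congrFun h (σ i)) i
  simp [permChannel, hne] at this

theorem gl1_permChannel {L : ℕ} (σ : Equiv.Perm (Fin L)) : Gl1 (permChannel σ) := by
  refine ⟨.of_mul_eq_one_right (permChannel σ.symm) ?_, fun j => by
    simp [permChannel]⟩
  ext i j
  simp [permChannel, Matrix.mul_apply, Matrix.one_apply]

theorem diagEmbed_eq_tensorAct_permChannel {L K : ℕ} (σ : Equiv.Perm (Fin L)) (p : Fin L → ℝ) :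
    diagEmbed p K = tensorAct (fun _ => permChannel σ) (diagEmbed (p ∘ σ) K) := by
  ext y
  rw [tensorAct_diagEmbed, diagEmbed, ← Equiv.sum_comp σ]
  simp [permChannel, Finset.prod_ite_zero]

theorem exists_perm_of_diagEmbed_eq {L K : ℕ} (hK : 3 ≤ K)
    {X : Fin K → Matrix (Fin L) (Fin L) ℝ} {p q : Fin L → ℝ} (hp : ∀ i, 0 < p i)
    (hX : ∀ k, Gl1 (X k)) (hq : ∀ i, 0 < q i)
    (h : diagEmbed p K = tensorAct X (diagEmbed q K)) :
    ∃ σ : Equiv.Perm (Fin L), (∀ k, X k = permChannel σ) ∧ q = p ∘ σ := by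
  have hmul {k l : Fin K} (hkl : k ≠ l) (a c j : Fin L) :
      X k a j * X l c j = if a = c then X k a j else 0 := by
    obtain ⟨m, hm⟩ := Finset.exists_mem_notMem_of_card_lt_card (s := {k, l})
      (t := (Finset.univ : Finset (Fin K)))
      (by rw [Finset.card_pair hkl, Finset.card_univ, Fintype.card_fin]; omega)
    have hm := hm.2
    simp only [Finset.mem_insert, Finset.mem_singleton, not_or] at hm
    exact mul_entry_eq_of_diagEmbed_eq hX hq h hkl (Ne.symm hm.1) (Ne.symm hm.2) a c j
  let k₀ : Fin K := ⟨0, by omega⟩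
  have hne (j : Fin L) : ∃ a, X k₀ a j ≠ 0 := by
    by_contra! h0
    simpa [h0] using (hX k₀).2 j
  choose σ hσ using hne
  have hother (l : Fin K) (hl : l ≠ k₀) : X l = permChannel σ := by
    ext c j
    apply mul_left_cancel₀ (hσ j)
    rw [hmul hl.symm]
    simp [permChannel, eq_comm]
  have hall (l : Fin K) : X l = permChannel σ := by
    by_cases hl : l = k₀
    · subst hl
      let k₁ : Fin K := ⟨1, by omega⟩
      have h10 : k₁ ≠ k₀ := by simp [k₁, k₀]
      ext c j
      have := hmul h10 (σ j) c j
      rw [hother k₁ h10] at this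
      simpa [permChannel, eq_comm] using this
    · exact hother l hl
  have hpc (c : Fin L) : p c = ∑ i, if c = σ i then q i else 0 := by
    have := congrFun h fun _ => c
    rw [tensorAct_diagEmbed] at this
    simp only [hall] at this
    have hK0 : K ≠ 0 := by omega
    have hne : Nonempty (Fin K) := ⟨k₀⟩
    simpa [diagEmbed, permChannel, hK0] using this
  have hsurj : Function.Surjective σ := by
    intro c
    by_contra! h0
    have := hpc c
    simp only [fun i => (h0 i).symm, if_false, Finset.sum_const_zero] at this
    exact (hp c).ne' this
  have hbij := Finite.surjective_iff_bijective.1 hsurj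
  refine ⟨Equiv.ofBijective σ hbij, hall, ?_⟩
  ext j
  simp [hpc, hbij.1.eq_iff]

theorem number_of_solutions (L K : ℕ) (hL : 1 ≤ L) (hK : 3 ≤ K)
    (p : Fin L → ℝ) (hp : probPos p) :
    {t : (Fin K → Matrix (Fin L) (Fin L) ℝ) × (Fin L → ℝ) |
      (∀ k, Gl1 (t.1 k)) ∧ probPos t.2 ∧
      diagEmbed p K = tensorAct t.1 (diagEmbed t.2 K)}.ncard
      = Nat.factorial L := by
  let F (σ : Equiv.Perm (Fin L)) : (Fin K → Matrix (Fin L) (Fin L) ℝ) × (Fin L → ℝ) :=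
    (fun _ => permChannel σ, p ∘ σ)
  have hF : Function.Injective F := fun σ τ h =>
    DFunLike.coe_injective
      (permChannel_injective (congrFun (congrArg Prod.fst h) (⟨0, by omega⟩ : Fin K)))
  have hset : {t : (Fin K → Matrix (Fin L) (Fin L) ℝ) × (Fin L → ℝ) |
      (∀ k, Gl1 (t.1 k)) ∧ probPos t.2 ∧
      diagEmbed p K = tensorAct t.1 (diagEmbed t.2 K)} = F '' Set.univ := by
    ext ⟨X, q⟩
    constructor
    · rintro ⟨hX, hq, h⟩
      obtain ⟨σ, hXσ, hqσ⟩ := exists_perm_of_diagEmbed_eq hK hp.1 hX hq.1 h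
      exact ⟨σ, Set.mem_univ _, Prod.ext (funext fun k => (hXσ k).symm) hqσ.symm⟩
    · rintro ⟨σ, -, h⟩
      obtain ⟨rfl, rfl⟩ := Prod.mk.inj h
      exact ⟨fun _ => gl1_permChannel σ,
        ⟨fun i => hp.1 _, (Equiv.sum_comp σ p).trans hp.2⟩,
        diagEmbed_eq_tensorAct_permChannel σ p⟩
  rw [hset, Set.ncard_image_of_injective _ hF, Set.ncard_univ, Nat.card_perm, Nat.card_fin]
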